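/- Cyclic edge correlation: For p ∈ [0,1/2] and any edge e of a finite graph G, the probability that e is open under the random even subgraph measure ρ_p equals one half of the probability under the random-cluster measure φ_{2p,2} that e is open and belongs to a cycle of the open graph. Consequently, the mean number of edges of the random even subgraph equals half the mean number of cyclic open edges under φ_{2p,2}. -/

import Mathlib

open Finset
open scoped Classical

/-- An edge set is even if every vertex is incident to an even number of its edges. -/
def EvenSet {V : Type} [Fintype V] [DecidableEq V] (F : Finset (Sym2 V)) : Prop :=
  ∀ v : V, Even (F.filter (fun e => v ∈ e)).card

/-- `C` is the edge set of a cycle of `G`. -/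
def IsCycleSet {V : Type} (G : SimpleGraph V) (C : Finset (Sym2 V)) : Prop :=
  ∃ (v : V) (w : G.Walk v v), w.IsCycle ∧ C = w.edges.toFinset

/-- `e` is a cyclic edge of the open graph `(V, ω)`: it lies on a cycle of `(V, ω)`. -/
def CyclicIn {V : Type} (G : SimpleGraph V) (ω : Finset (Sym2 V)) (e : Sym2 V) : Prop :=
  ∃ C, IsCycleSet G C ∧ C ⊆ ω ∧ e ∈ C

/-- The number of connected components `k(ω)` of the open graph `(V, ω)`. -/
noncomputable def numComp {V : Type} (ω : Finset (Sym2 V)) : ℕ :=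
  Nat.card (SimpleGraph.fromEdgeSet (↑ω : Set (Sym2 V))).ConnectedComponent

/-- The random-cluster weight `(2p)^{|η(ω)|}(1-2p)^{|E∖η(ω)|}2^{k(ω)}`. -/
noncomputable def rcWeight {V : Type} [Fintype V] [DecidableEq V]
    (G : SimpleGraph V) [DecidableRel G.Adj] (p : ℝ) (ω : Finset (Sym2 V)) : ℝ :=
  (2 * p) ^ ω.card * (1 - 2 * p) ^ (G.edgeFinset.card - ω.card) * 2 ^ numComp ω

/-- The even-subgraph weight `p^{|F|}(1-p)^{|E∖F|}`. -/
noncomputable def evWeight {V : Type} [Fintype V] [DecidableEq V]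
    (G : SimpleGraph V) [DecidableRel G.Adj] (p : ℝ) (F : Finset (Sym2 V)) : ℝ :=
  p ^ F.card * (1 - p) ^ (G.edgeFinset.card - F.card)

noncomputable def sgnB (b : Bool) : ℤ := if b then -1 else 1

noncomputable def spinW {V : Type} [Fintype V] (σ : V → Bool) (e : Sym2 V) : ℤ :=
  ∏ v : V, if v ∈ e then sgnB (σ v) else 1

def Compat {V : Type} (ω : Finset (Sym2 V)) (σ : V → Bool) : Prop :=
  ∀ u v : V, s(u, v) ∈ ω → σ u = σ v

lemma spinW_mk {V : Type} [Fintype V] (σ : V → Bool) (u v : V) (h : u ≠ v) :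
    spinW σ s(u, v) = if σ u = σ v then 1 else -1 := by
  have : spinW σ s(u, v) = sgnB (σ u) * sgnB (σ v) := by
    unfold spinW
    rw [← Finset.prod_filter]
    have : (Finset.univ.filter (fun x => x ∈ s(u, v))) = {u, v} := by
      ext x; simp
    rw [this, Finset.prod_pair h]
  rw [this]
  cases σ u <;> cases σ v <;> simp [sgnB]

lemma prod_spinW {V : Type} [Fintype V] [DecidableEq V] (σ : V → Bool) (F : Finset (Sym2 V)) :
    ∏ e ∈ F, spinW σ e = ∏ v : V, sgnB (σ v) ^ (F.filter (fun e => v ∈ e)).card := by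
  unfold spinW
  rw [Finset.prod_comm]
  refine Finset.prod_congr rfl fun v _ => ?_
  rw [← Finset.prod_const, Finset.prod_filter]
  refine Finset.prod_congr rfl fun e _ => ?_
  split_ifs <;> rfl

lemma sum_spin {V : Type} [Fintype V] [DecidableEq V] (F : Finset (Sym2 V)) :
    ∑ σ : V → Bool, ∏ e ∈ F, spinW σ e = if EvenSet F then 2 ^ Fintype.card V else 0 := by
  simp_rw [prod_spinW]
  have h := Finset.prod_univ_sum (fun _ : V => (Finset.univ : Finset Bool))
    (fun v b => sgnB b ^ (F.filter (fun e => v ∈ e)).card)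
  rw [Fintype.piFinset_univ] at h
  rw [← h]
  have h2 : ∀ n : ℕ, ∑ b : Bool, sgnB b ^ n = if Even n then 2 else 0 := by
    intro n
    by_cases hn : Even n
    · simp [sgnB, hn]
    · simp [sgnB, hn, (Nat.not_even_iff_odd.1 hn).neg_one_pow]
  simp_rw [h2]
  split_ifs with hF
  · rw [Finset.prod_congr rfl (fun v _ => if_pos (hF v))]
    simp
  · unfold EvenSet at hF
    push Not at hF
    obtain ⟨v, hv⟩ := hF
    exact Finset.prod_eq_zero (Finset.mem_univ v) (if_neg (by simpa using hv))

lemma prod_one_add_spin {V : Type} [Fintype V] [DecidableEq V] (ω : Finset (Sym2 V))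
    (hω : ∀ e ∈ ω, ¬ e.IsDiag) (σ : V → Bool) :
    ∏ e ∈ ω, (1 + spinW σ e) = if Compat ω σ then 2 ^ ω.card else 0 := by
  split_ifs with h
  · rw [← Finset.prod_const]
    refine Finset.prod_congr rfl fun e he => ?_
    induction e using Sym2.ind with
    | _ u v =>
      have := hω _ he
      rw [spinW_mk σ u v (by simpa using this), if_pos (h u v he)]
      norm_num
  · unfold Compat at h
    push Not at h
    obtain ⟨u, v, he, hs⟩ := h
    refine Finset.prod_eq_zero he ?_
    have := hω _ he
    rw [spinW_mk σ u v (by simpa using this), if_neg hs]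
    norm_num

noncomputable def nEven {V : Type} [Fintype V] [DecidableEq V] (ω : Finset (Sym2 V)) : ℕ :=
  (ω.powerset.filter (fun F => EvenSet F)).card

noncomputable def nCompat {V : Type} [Fintype V] [DecidableEq V] (ω : Finset (Sym2 V)) : ℕ :=
  (Finset.univ.filter (fun σ : V → Bool => Compat ω σ)).card

lemma nEven_eq {V : Type} [Fintype V] [DecidableEq V] (ω : Finset (Sym2 V))
    (hω : ∀ e ∈ ω, ¬ e.IsDiag) :
    nEven ω * 2 ^ Fintype.card V = 2 ^ ω.card * nCompat ω := by
  have h1 : ∑ σ : V → Bool, ∏ e ∈ ω, (1 + spinW σ e) = 2 ^ ω.card * (nCompat ω : ℤ) := by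
    simp_rw [prod_one_add_spin ω hω]
    rw [← Finset.sum_filter, Finset.sum_const, nCompat, nsmul_eq_mul, mul_comm]
  have h2 : ∑ σ : V → Bool, ∏ e ∈ ω, (1 + spinW σ e)
      = (nEven ω : ℤ) * 2 ^ Fintype.card V := by
    simp_rw [Finset.prod_one_add]
    rw [Finset.sum_comm]
    simp_rw [sum_spin]
    rw [← Finset.sum_filter, Finset.sum_const, nEven, nsmul_eq_mul]
  exact_mod_cast h2.symm.trans h1

lemma compat_reachable {V : Type} {ω : Finset (Sym2 V)} {σ : V → Bool} (h : Compat ω σ)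
    {u v : V} (huv : (SimpleGraph.fromEdgeSet (↑ω : Set (Sym2 V))).Reachable u v) :
    σ u = σ v := by
  obtain ⟨w⟩ := huv
  induction w with
  | nil => rfl
  | cons hadj _ ih =>
    rw [SimpleGraph.fromEdgeSet_adj] at hadj
    exact (h _ _ (by simpa using hadj.1)).trans ih

lemma reachable_of_mem {V : Type} {ω : Finset (Sym2 V)} {u v : V} (h : s(u, v) ∈ ω) :
    (SimpleGraph.fromEdgeSet (↑ω : Set (Sym2 V))).Reachable u v := by
  by_cases huv : u = v
  · subst huv; rfl
  · exact SimpleGraph.Adj.reachable (by rw [SimpleGraph.fromEdgeSet_adj]; exact ⟨by simpa using h, huv⟩)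

lemma nCompat_eq {V : Type} [Fintype V] [DecidableEq V] (ω : Finset (Sym2 V)) :
    nCompat ω = 2 ^ numComp ω := by
  let H := SimpleGraph.fromEdgeSet (↑ω : Set (Sym2 V))
  let E : {σ : V → Bool // Compat ω σ} ≃ (H.ConnectedComponent → Bool) :=
    { toFun := fun σ c => SimpleGraph.ConnectedComponent.lift σ.1
        (fun _ _ w _ => compat_reachable σ.2 ⟨w⟩) c
      invFun := fun τ => ⟨fun v => τ (H.connectedComponentMk v), fun u v h => by
        exact congrArg τ (SimpleGraph.ConnectedComponent.sound (reachable_of_mem h))⟩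
      left_inv := fun σ => by ext v; rfl
      right_inv := fun τ => by
        ext c
        induction c using SimpleGraph.ConnectedComponent.ind with
        | _ v => rfl }
  have h1 : nCompat ω = Nat.card {σ : V → Bool // Compat ω σ} := by
    rw [Nat.card_eq_fintype_card, Fintype.card_subtype, nCompat]
  rw [h1, Nat.card_congr E, Nat.card_fun, numComp]
  simp [H]

lemma nCompat_erase_reach {V : Type} [Fintype V] [DecidableEq V] (ω : Finset (Sym2 V)) (u v : V)
    (h : (SimpleGraph.fromEdgeSet (↑(ω.erase s(u, v)) : Set (Sym2 V))).Reachable u v) :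
    nCompat (ω.erase s(u, v)) = nCompat ω := by
  unfold nCompat
  congr 1
  ext σ
  simp only [Finset.mem_filter, Finset.mem_univ, true_and]
  constructor
  · intro hc a b hab
    by_cases he : s(a, b) = s(u, v)
    · have := compat_reachable hc h
      rcases Sym2.eq_iff.1 he with ⟨rfl, rfl⟩ | ⟨rfl, rfl⟩
      · exact this
      · exact this.symm
    · exact hc a b (Finset.mem_erase.2 ⟨he, hab⟩)
  · intro hc a b hab
    exact hc a b (Finset.mem_of_mem_erase hab)

lemma nCompat_erase_not_reach {V : Type} [Fintype V] [DecidableEq V] (ω : Finset (Sym2 V))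
    (u v : V) (hmem : s(u, v) ∈ ω)
    (h : ¬ (SimpleGraph.fromEdgeSet (↑(ω.erase s(u, v)) : Set (Sym2 V))).Reachable u v) :
    nCompat (ω.erase s(u, v)) = 2 * nCompat ω := by
  set H := SimpleGraph.fromEdgeSet (↑(ω.erase s(u, v)) : Set (Sym2 V)) with hH
  have hiff : ∀ σ : V → Bool, Compat ω σ ↔ Compat (ω.erase s(u, v)) σ ∧ σ u = σ v := by
    intro σ
    constructor
    · intro hc
      exact ⟨fun a b hab => hc a b (Finset.mem_of_mem_erase hab), hc _ _ hmem⟩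
    · rintro ⟨hc, huv⟩ a b hab
      by_cases he : s(a, b) = s(u, v)
      · rcases Sym2.eq_iff.1 he with ⟨rfl, rfl⟩ | ⟨rfl, rfl⟩
        · exact huv
        · exact huv.symm
      · exact hc a b (Finset.mem_erase.2 ⟨he, hab⟩)
  let fl : (V → Bool) → (V → Bool) := fun σ x => if H.Reachable u x then !(σ x) else σ x
  have flfl : ∀ σ, fl (fl σ) = σ := by
    intro σ; funext x; simp only [fl]; split_ifs <;> simp
  have flc : ∀ σ, Compat (ω.erase s(u, v)) σ → Compat (ω.erase s(u, v)) (fl σ) := by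
    intro σ hc a b hab
    have hr : H.Reachable a b := reachable_of_mem hab
    have : H.Reachable u a ↔ H.Reachable u b := ⟨fun k => k.trans hr, fun k => k.trans hr.symm⟩
    simp only [fl, this, hc a b hab]
  have flu : ∀ σ, fl σ u = !(σ u) := by intro σ; simp [fl]
  have flv : ∀ σ, fl σ v = σ v := by intro σ; simp [fl, h]
  unfold nCompat
  rw [← Finset.card_filter_add_card_filter_not
    (s := Finset.univ.filter (fun σ : V → Bool => Compat (ω.erase s(u, v)) σ))
    (fun σ => σ u = σ v), two_mul]
  simp only [Finset.filter_filter]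
  congr 1
  · congr 1; ext σ; simp [hiff]
  · refine Finset.card_nbij' fl fl ?_ ?_ (fun σ _ => flfl σ) (fun σ _ => flfl σ)
    · intro σ hσ
      simp only [Finset.coe_filter, Finset.mem_univ, true_and, Set.mem_ofPred_eq] at hσ ⊢
      rw [hiff, flu, flv]
      refine ⟨flc σ hσ.1, ?_⟩
      have := hσ.2
      revert this
      cases σ u <;> cases σ v <;> simp
    · intro σ hσ
      simp only [Finset.coe_filter, Finset.mem_univ, true_and, Set.mem_ofPred_eq] at hσ ⊢
      rw [hiff] at hσ
      rw [flu, flv, hσ.2]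
      refine ⟨flc σ hσ.1, ?_⟩
      simp

lemma cyclic_iff {V : Type} [Fintype V] [DecidableEq V] (G : SimpleGraph V) [DecidableRel G.Adj]
    (ω : Finset (Sym2 V)) (hω : ω ⊆ G.edgeFinset) (u v : V) (hmem : s(u, v) ∈ ω) :
    CyclicIn G ω s(u, v) ↔
      (SimpleGraph.fromEdgeSet (↑(ω.erase s(u, v)) : Set (Sym2 V))).Reachable u v := by
  have huv : G.Adj u v := by simpa using hω hmem
  let H := SimpleGraph.fromEdgeSet (↑ω : Set (Sym2 V))
  have hHadj : H.Adj u v := by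
    simp only [H, SimpleGraph.fromEdgeSet_adj]; exact ⟨by simpa using hmem, huv.ne⟩
  have hHe : H.edgeSet ⊆ (↑ω : Set (Sym2 V)) := by
    simp only [H, SimpleGraph.edgeSet_fromEdgeSet]; exact Set.sdiff_subset
  have hE : H.deleteEdges {s(u, v)} =
      SimpleGraph.fromEdgeSet (↑(ω.erase s(u, v)) : Set (Sym2 V)) := by
    ext a b
    simp only [H, SimpleGraph.deleteEdges_adj, SimpleGraph.fromEdgeSet_adj, Finset.coe_erase,
      Set.mem_sdiff, Set.mem_singleton_iff]
    tauto
  have key := SimpleGraph.adj_and_reachable_delete_edges_iff_exists_cycle (G := H) (v := u) (w := v)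
  rw [hE] at key
  have key2 : _ ↔ _ := ⟨fun h => key.1 ⟨hHadj, h⟩, fun h => (key.2 h).2⟩
  rw [key2]
  constructor
  · rintro ⟨C, ⟨x, w, hw, rfl⟩, hsub, he⟩
    have ht : ∀ e ∈ w.edges, e ∈ H.edgeSet := by
      intro e hew
      simp only [H, SimpleGraph.edgeSet_fromEdgeSet]
      exact ⟨by simpa using hsub (by simpa using hew),
        G.not_isDiag_of_mem_edgeSet (w.edges_subset_edgeSet hew)⟩
    exact ⟨x, w.transfer H ht, hw.transfer ht, by simpa using he⟩
  · rintro ⟨x, w, hw, he⟩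
    have ht : ∀ e ∈ w.edges, e ∈ G.edgeSet := by
      intro e hew
      have := hω (by simpa using hHe (w.edges_subset_edgeSet hew))
      simpa using this
    refine ⟨_, ⟨x, w.transfer G ht, hw.transfer ht, rfl⟩, ?_, by simpa using he⟩
    intro e hew
    have : e ∈ w.edges := by simpa using hew
    simpa using hHe (w.edges_subset_edgeSet this)

lemma nEven_mem {V : Type} [Fintype V] [DecidableEq V] (G : SimpleGraph V) [DecidableRel G.Adj]
    (ω : Finset (Sym2 V)) (hω : ω ⊆ G.edgeFinset) (e : Sym2 V) :
    2 * (ω.powerset.filter (fun F => EvenSet F ∧ e ∈ F)).card =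
      if e ∈ ω ∧ CyclicIn G ω e then nEven ω else 0 := by
  by_cases he : e ∈ ω
  swap
  · rw [if_neg (fun h => he h.1), Finset.filter_false_of_mem]
    · simp
    · intro F hF h
      exact he (Finset.mem_powerset.1 hF h.2)
  have hd : ∀ f ∈ ω, ¬ f.IsDiag := fun f hf =>
    G.not_isDiag_of_mem_edgeSet (by simpa using hω hf)
  have hsplit : (ω.powerset.filter (fun F => EvenSet F ∧ e ∈ F)).card + nEven (ω.erase e)
      = nEven ω := by
    unfold nEven
    rw [← Finset.card_filter_add_card_filter_not
      (s := ω.powerset.filter (fun F => EvenSet F)) (fun F => e ∈ F)]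
    simp only [Finset.filter_filter]
    congr 2
    ext F
    simp only [Finset.mem_filter, Finset.mem_powerset, Finset.subset_erase]
    tauto
  have h1 := nEven_eq ω hd
  have h2 := nEven_eq (ω.erase e) (fun f hf => hd f (Finset.mem_of_mem_erase hf))
  have hc : ω.card = (ω.erase e).card + 1 := (Finset.card_erase_add_one he).symm
  have hpos : 0 < 2 ^ Fintype.card V := by positivity
  induction e using Sym2.ind with
  | _ u v =>
    have hcy := cyclic_iff G ω hω u v he
    by_cases hr : CyclicIn G ω s(u, v)
    · rw [if_pos ⟨he, hr⟩]
      rw [nCompat_erase_reach ω u v (hcy.1 hr)] at h2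
      rw [hc, pow_succ] at h1
      have : nEven ω = 2 * nEven (ω.erase s(u, v)) := by
        apply Nat.eq_of_mul_eq_mul_right hpos
        linarith
      omega
    · rw [if_neg (fun h => hr h.2)]
      rw [nCompat_erase_not_reach ω u v he (fun h => hr (hcy.2 h))] at h2
      rw [hc, pow_succ] at h1
      have : nEven ω = nEven (ω.erase s(u, v)) := by
        apply Nat.eq_of_mul_eq_mul_right hpos
        linarith
      omega

lemma rc_eq {V : Type} [Fintype V] [DecidableEq V] (G : SimpleGraph V) [DecidableRel G.Adj]
    (p : ℝ) (ω : Finset (Sym2 V)) (hω : ω ⊆ G.edgeFinset) :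
    rcWeight G p ω = 2 ^ Fintype.card V *
      (p ^ ω.card * (1 - 2 * p) ^ (G.edgeFinset.card - ω.card) * nEven ω) := by
  have hd : ∀ f ∈ ω, ¬ f.IsDiag := fun f hf =>
    G.not_isDiag_of_mem_edgeSet (by simpa using hω hf)
  have h := nEven_eq ω hd
  rw [nCompat_eq] at h
  have h' : (nEven ω : ℝ) * 2 ^ Fintype.card V = 2 ^ ω.card * 2 ^ numComp ω := by exact_mod_cast h
  unfold rcWeight
  rw [mul_pow]
  linear_combination (-(p ^ ω.card * (1 - 2 * p) ^ (G.edgeFinset.card - ω.card))) * h'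

lemma sum_above {V : Type} [DecidableEq V] (E F : Finset (Sym2 V)) (hF : F ⊆ E) (p : ℝ) :
    ∑ ω ∈ E.powerset.filter (fun ω => F ⊆ ω), p ^ ω.card * (1 - 2 * p) ^ (E.card - ω.card)
      = p ^ F.card * (1 - p) ^ (E.card - F.card) := by
  have h := Finset.sum_pow_mul_eq_add_pow p (1 - 2 * p) (E \ F)
  have h1 : p + (1 - 2 * p) = 1 - p := by ring
  rw [h1, Finset.card_sdiff_of_subset hF] at h
  rw [← h, Finset.mul_sum]
  refine Finset.sum_nbij' (fun ω => ω \ F) (fun T => F ∪ T) ?_ ?_ ?_ ?_ ?_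
  · intro ω hω
    simp only [Finset.mem_filter, Finset.mem_powerset] at hω ⊢
    exact Finset.sdiff_subset_sdiff hω.1 subset_rfl
  · intro T hT
    simp only [Finset.mem_filter, Finset.mem_powerset] at hT ⊢
    exact ⟨Finset.union_subset hF (hT.trans Finset.sdiff_subset), Finset.subset_union_left⟩
  · intro ω hω
    simp only [Finset.mem_filter, Finset.mem_powerset] at hω
    exact Finset.union_sdiff_of_subset hω.2
  · intro T hT
    simp only [Finset.mem_powerset] at hT
    exact Finset.union_sdiff_cancel_left (Finset.disjoint_of_subset_right hT Finset.disjoint_sdiff)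
  · intro ω hω
    simp only [Finset.mem_filter, Finset.mem_powerset] at hω
    have hc := Finset.card_le_card hω.2
    have hc2 := Finset.card_le_card hω.1
    rw [Finset.card_sdiff_of_subset hω.2, ← mul_assoc, ← pow_add]
    congr 2
    · omega
    · omega

lemma sum_coupling {V : Type} [Fintype V] [DecidableEq V] (G : SimpleGraph V)
    [DecidableRel G.Adj] (p : ℝ) (P : Finset (Sym2 V) → Prop) [DecidablePred P] :
    ∑ ω ∈ G.edgeFinset.powerset, p ^ ω.card * (1 - 2 * p) ^ (G.edgeFinset.card - ω.card) *
        ((ω.powerset.filter (fun F => P F)).card : ℝ)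
      = ∑ F ∈ G.edgeFinset.powerset.filter (fun F => P F), evWeight G p F := by
  have : ∀ F ∈ G.edgeFinset.powerset.filter (fun F => P F), evWeight G p F =
      ∑ ω ∈ G.edgeFinset.powerset.filter (fun ω => F ⊆ ω),
        p ^ ω.card * (1 - 2 * p) ^ (G.edgeFinset.card - ω.card) := by
    intro F hF
    rw [sum_above _ _ (Finset.mem_powerset.1 (Finset.mem_filter.1 hF).1), evWeight]
  rw [Finset.sum_congr rfl this]
  rw [Finset.sum_comm' (t' := G.edgeFinset.powerset)
    (s' := fun ω => ω.powerset.filter (fun F => P F))]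
  · refine Finset.sum_congr rfl fun ω _ => ?_
    rw [Finset.sum_const, nsmul_eq_mul, mul_comm]
  · intro F ω
    simp only [Finset.mem_filter, Finset.mem_powerset]
    constructor
    · rintro ⟨⟨_, h2⟩, h3, h4⟩; exact ⟨⟨h4, h2⟩, h3⟩
    · rintro ⟨⟨h4, h2⟩, h3⟩; exact ⟨⟨h4.trans h3, h2⟩, h3, h4⟩

lemma Z_eq {V : Type} [Fintype V] [DecidableEq V] (G : SimpleGraph V) [DecidableRel G.Adj]
    (p : ℝ) : ∑ ω ∈ G.edgeFinset.powerset, rcWeight G p ω = 2 ^ Fintype.card V *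
      ∑ F ∈ G.edgeFinset.powerset.filter (fun F => EvenSet F), evWeight G p F := by
  rw [← sum_coupling G p (fun F => EvenSet F), Finset.mul_sum]
  refine Finset.sum_congr rfl fun ω hω => ?_
  rw [rc_eq G p ω (Finset.mem_powerset.1 hω), nEven]

lemma num_eq {V : Type} [Fintype V] [DecidableEq V] (G : SimpleGraph V) [DecidableRel G.Adj]
    (p : ℝ) (e : Sym2 V) :
    ∑ ω ∈ G.edgeFinset.powerset.filter (fun ω => e ∈ ω ∧ CyclicIn G ω e), rcWeight G p ω =
      2 ^ Fintype.card V * (2 *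
      ∑ F ∈ G.edgeFinset.powerset.filter (fun F => EvenSet F ∧ e ∈ F), evWeight G p F) := by
  rw [← sum_coupling G p (fun F => EvenSet F ∧ e ∈ F), Finset.mul_sum, Finset.mul_sum,
    Finset.sum_filter]
  refine Finset.sum_congr rfl fun ω hω => ?_
  have h := nEven_mem G ω (Finset.mem_powerset.1 hω) e
  have h' : (2 : ℝ) * ((ω.powerset.filter (fun F => EvenSet F ∧ e ∈ F)).card : ℝ) =
      if e ∈ ω ∧ CyclicIn G ω e then (nEven ω : ℝ) else 0 := by exact_mod_cast h
  rw [mul_left_comm (2 : ℝ), h', rc_eq G p ω (Finset.mem_powerset.1 hω)]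
  split_ifs <;> simp

/-- For `p ∈ [0,1/2]` and an edge `e` of `G`, the probability that `e` is open under the
random even subgraph measure `ρ_p` equals half the probability under the random-cluster
measure `φ_{2p,2}` that `e` is a cyclic edge of the open graph.  Consequently the mean
number of open edges under `ρ_p` is half the mean number of cyclic open edges
under `φ_{2p,2}`. -/
theorem cyclic_edge_correlation {V : Type} [Fintype V] [DecidableEq V]
    (G : SimpleGraph V) [DecidableRel G.Adj] (p : ℝ) (hp0 : 0 ≤ p) (hp : p ≤ 1 / 2) :
    (∀ e ∈ G.edgeFinset,
      (∑ F ∈ G.edgeFinset.powerset.filter (fun F => EvenSet F ∧ e ∈ F), evWeight G p F) /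
          (∑ F ∈ G.edgeFinset.powerset.filter (fun F => EvenSet F), evWeight G p F) =
        (1 / 2) *
          (∑ ω ∈ G.edgeFinset.powerset.filter (fun ω => e ∈ ω ∧ CyclicIn G ω e),
              rcWeight G p ω) /
            (∑ ω ∈ G.edgeFinset.powerset, rcWeight G p ω)) ∧
    (∑ F ∈ G.edgeFinset.powerset.filter (fun F => EvenSet F), (F.card : ℝ) * evWeight G p F) /
        (∑ F ∈ G.edgeFinset.powerset.filter (fun F => EvenSet F), evWeight G p F) =
      (1 / 2) *
        (∑ ω ∈ G.edgeFinset.powerset,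
            ((ω.filter (fun e => CyclicIn G ω e)).card : ℝ) * rcWeight G p ω) /
          (∑ ω ∈ G.edgeFinset.powerset, rcWeight G p ω) := by
  have hZ := Z_eq G p
  have h2 : (2 : ℝ) ^ Fintype.card V ≠ 0 := by positivity
  constructor
  · intro e _
    rw [num_eq, hZ, mul_left_comm, mul_div_mul_left _ _ h2]
    congr 1
    ring
  · have hA : ∑ F ∈ G.edgeFinset.powerset.filter (fun F => EvenSet F),
        (F.card : ℝ) * evWeight G p F = ∑ e ∈ G.edgeFinset,
        ∑ F ∈ G.edgeFinset.powerset.filter (fun F => EvenSet F ∧ e ∈ F), evWeight G p F := by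
      simp_rw [← Finset.filter_filter]
      simp_rw [Finset.sum_filter (fun F => _ ∈ F)]
      rw [Finset.sum_comm]
      refine Finset.sum_congr rfl fun F hF => ?_
      have hF' := Finset.mem_powerset.1 (Finset.mem_filter.1 hF).1
      rw [← Finset.sum_filter, Finset.filter_mem_eq_inter, Finset.inter_eq_right.2 hF',
        Finset.sum_const, nsmul_eq_mul]
    have hB : ∑ ω ∈ G.edgeFinset.powerset,
        ((ω.filter (fun e => CyclicIn G ω e)).card : ℝ) * rcWeight G p ω =
        ∑ e ∈ G.edgeFinset, ∑ ω ∈ G.edgeFinset.powerset.filter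
          (fun ω => e ∈ ω ∧ CyclicIn G ω e), rcWeight G p ω := by
      simp_rw [Finset.sum_filter]
      rw [Finset.sum_comm]
      refine Finset.sum_congr rfl fun ω hω => ?_
      have hω' := Finset.mem_powerset.1 hω
      rw [← Finset.sum_filter, ← Finset.filter_filter, Finset.filter_mem_eq_inter,
        Finset.inter_eq_right.2 hω', Finset.sum_const, nsmul_eq_mul]
    rw [hA, hB, Finset.sum_congr rfl (fun e _ => num_eq G p e), ← Finset.mul_sum, hZ,
      mul_left_comm, mul_div_mul_left _ _ h2, ← Finset.mul_sum]
    congr 1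
    ring
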